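/- Let P > 0 and λ > 0 be real numbers and N ≥ 1 an integer. Then the function f(x) := x − (1/2)·log₂( 1 + (1/N + x/λ)·P ) has exactly one zero in (0, ∞); that is, the equation R = (1/2)·log₂(1 + (1/N + R/λ)P) has a unique positive solution R. -/

import Mathlib

/-- A continuous convex function on `[0, ∞)` that is negative at `0` and nonnegative somewhere has
exactly one positive zero. -/
theorem ConvexOn.existsUnique_pos_zero {f : ℝ → ℝ} (hf : ConvexOn ℝ (Set.Ici 0) f)
    (hc : ContinuousOn f (Set.Ici 0)) (h0 : f 0 < 0) {y : ℝ} (hy : 0 ≤ y) (hfy : 0 ≤ f y) :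
    ∃! x : ℝ, 0 < x ∧ f x = 0 := by
  have uniq : ∀ a b : ℝ, 0 < a → a < b → f a = 0 → f b ≠ 0 := by
    intro a b ha hab hfa hfb
    have hb : 0 < b := ha.trans hab
    have h := hf.2 (Set.mem_Ici.2 le_rfl) (Set.mem_Ici.2 hb.le)
      (sub_nonneg.2 ((div_le_one hb).2 hab.le)) (div_pos ha hb).le (sub_add_cancel 1 (a / b))
    simp only [smul_eq_mul, mul_zero, zero_add, div_mul_cancel₀ a hb.ne', hfa, hfb,
      add_zero] at h
    exact absurd h (not_le.2 (mul_neg_of_pos_of_neg (sub_pos.2 ((div_lt_one hb).2 hab)) h0))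
  obtain ⟨x, hx, hfx⟩ := intermediate_value_Icc hy
    (hc.mono Set.Icc_subset_Ici_self) ⟨h0.le, hfy⟩
  have hx0 : 0 < x := hx.1.lt_of_ne (by rintro rfl; exact h0.ne hfx)
  refine ⟨x, ⟨hx0, hfx⟩, fun z hz => ?_⟩
  rcases lt_trichotomy z x with h | h | h
  · exact absurd hfx (uniq z x hz.1 h hz.2)
  · exact h
  · exact absurd hz.2 (uniq x z hx0 h hfx)

/-- The logarithm of an affine function is eventually dominated by any positive linear function. -/
theorem Real.exists_log_affine_le_mul {A B c : ℝ} (hA : 0 < A) (hB : 0 < B) (hc : 0 < c) :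
    ∃ y : ℝ, 0 ≤ y ∧ Real.log (A + B * y) ≤ c * y := by
  obtain ⟨K, hK⟩ : ∃ K, K = A * c / (2 * B) - 1 - Real.log (c / (2 * B)) := ⟨_, rfl⟩
  refine ⟨2 * |K| / c, by positivity, ?_⟩
  set y := 2 * |K| / c with hy
  have hy0 : 0 ≤ y := by positivity
  have hu : 0 < A + B * y := by positivity
  have hs : 0 < c / (2 * B) := by positivity
  have h1 := Real.log_le_sub_one_of_pos (mul_pos hu hs)
  rw [Real.log_mul hu.ne' hs.ne'] at h1
  have h2 : (A + B * y) * (c / (2 * B)) = A * c / (2 * B) + c * y / 2 := by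
    field_simp
  have h3 : c * y = 2 * |K| := by rw [hy]; field_simp
  linarith [le_abs_self K]

/-- A positive linear function meets the logarithm of an increasing affine function with constant
term above `1` at exactly one positive point. -/
theorem Real.existsUnique_pos_mul_sub_log_affine {A B c : ℝ} (hA : 1 < A) (hB : 0 < B)
    (hc : 0 < c) : ∃! x : ℝ, 0 < x ∧ c * x - Real.log (A + B * x) = 0 := by
  have hA0 : 0 < A := one_pos.trans hA
  have hpos : ∀ x ∈ Set.Ici (0 : ℝ), 0 < A + B * x := fun x hx =>
    add_pos_of_pos_of_nonneg hA0 (mul_nonneg hB.le hx)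
  obtain ⟨y, hy, hly⟩ := Real.exists_log_affine_le_mul hA0 hB hc
  refine ConvexOn.existsUnique_pos_zero (f := fun x => c * x - Real.log (A + B * x))
    ⟨convex_Ici 0, ?_⟩ ?_ ?_ hy (sub_nonneg.2 hly)
  · intro x hx z hz a b ha hb hab
    have h := strictConcaveOn_log_Ioi.concaveOn.2 (hpos x hx) (hpos z hz) ha hb hab
    simp only [smul_eq_mul] at h ⊢
    have e : a * (A + B * x) + b * (A + B * z) = A + B * (a * x + b * z) := by
      linear_combination A * hab
    rw [e] at h
    linarith
  · exact ContinuousOn.sub (by fun_prop)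
      (ContinuousOn.log (by fun_prop) fun x hx => (hpos x hx).ne')
  · simpa using Real.log_pos hA

/-- For `P > 0`, `λ > 0` and an integer `N ≥ 1`, the equation
`R = (1/2) log₂(1 + (1/N + R/λ) P)` has a unique positive real solution; equivalently,
`f(x) = x - (1/2) log₂(1 + (1/N + x/λ) P)` has exactly one zero in `(0, ∞)`. -/
theorem unique_positive_rate_threshold (P lam : ℝ) (N : ℕ)
    (hP : 0 < P) (hlam : 0 < lam) (hN : 1 ≤ N) :
    ∃! R : ℝ, 0 < R ∧ R = (1 / 2) * Real.logb 2 (1 + (1 / (N : ℝ) + R / lam) * P) := by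
  have hN0 : (0 : ℝ) < N := by exact_mod_cast hN
  have hl : 0 < Real.log 2 := Real.log_pos one_lt_two
  have hA : 1 < 1 + P / N := lt_add_of_pos_right 1 (div_pos hP hN0)
  refine (existsUnique_congr fun R => and_congr_right fun _ => ?_).mp
    (Real.existsUnique_pos_mul_sub_log_affine hA (div_pos hP hlam) (mul_pos two_pos hl))
  have e : 1 + (1 / (N : ℝ) + R / lam) * P = 1 + P / N + P / lam * R := by ring
  rw [e, Real.logb, sub_eq_zero, one_div_mul_eq_div, div_div, eq_div_iff (by positivity),
    mul_comm R, mul_comm (Real.log 2)]
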